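/- Consider the sequence of geometric block models G_n(r_s(n), r_d(n)) with τ = 1/2 (balanced communities, n even), radii 0 < r_d(n) ≤ r_s(n) ≤ 1/4 satisfying r_s(n) = Θ(r_d(n)) and n·r_s(n) → ∞. Define M_n as follows, writing r_s = r_s(n), r_d = r_d(n): if r_d ≤ r_s < 2r_d, then M_n = 3 r_s r_d / (r_s + r_d)²; if r_s ≥ 2r_d, then M_n = 3(r_s² + 4r_d²) / (4(r_s + r_d)²). Then the average clustering coefficient C̄_n satisfies C̄_n − M_n → 0 in probability: for every ε > 0, P(|C̄_n − M_n| > ε) → 0 as n → ∞. -/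

import Mathlib

open MeasureTheory Finset

noncomputable section

/-- The periodic distance on `[0,1]`: `d(u,v) = min(|u-v|, 1-|u-v|)`. -/
def pdist (u v : ℝ) : ℝ := min |u - v| (1 - |u - v|)

/-- The law of `(X_1, …, X_n)`: the product of `n` uniform measures on `[0,1]`. -/
def gbmMeasure (n : ℕ) : Measure (Fin n → ℝ) :=
  Measure.pi fun _ => volume.restrict (Set.Icc (0 : ℝ) 1)

/-- The adjacency matrix of the geometric block model `G_n(r_s, r_d)` with
communities `V₁ = {0,…,m-1}` and `V₂ = {m,…,n-1}`: `A i i = 0`, and for `i ≠ j`,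
`A i j = 1[d(X_i,X_j) ≤ r_s]` if `i, j` are in the same community and
`A i j = 1[d(X_i,X_j) ≤ r_d]` otherwise. -/
def gbmA (n m : ℕ) (rs rd : ℝ) (X : Fin n → ℝ) (i j : Fin n) : ℝ :=
  if i = j then 0
  else if ((i : ℕ) < m ↔ (j : ℕ) < m) then
    (if pdist (X i) (X j) ≤ rs then 1 else 0)
  else (if pdist (X i) (X j) ≤ rd then 1 else 0)

/-- The degree `d_i = Σ_j A_ij` of node `i`. -/
def gbmDeg (n m : ℕ) (rs rd : ℝ) (X : Fin n → ℝ) (i : Fin n) : ℝ :=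
  ∑ j : Fin n, gbmA n m rs rd X i j

/-- The local (ordered) triangle count at node `i`: `Σ_{j≠k} A_ij A_jk A_ki`,
over ordered pairs of distinct vertices `j, k` different from `i`. -/
def localTri (n m : ℕ) (rs rd : ℝ) (X : Fin n → ℝ) (i : Fin n) : ℝ :=
  ∑ j : Fin n, ∑ k : Fin n,
    if j ≠ i ∧ k ≠ i ∧ j ≠ k then
      gbmA n m rs rd X i j * gbmA n m rs rd X j k * gbmA n m rs rd X k i
    else 0

/-- The average clustering coefficient
`C̄_n = (1/n) Σ_i (Σ_{j≠k} A_ij A_jk A_ki)/(d_i(d_i − 1))`, where any term with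
`d_i ≤ 1` is set to `0`. -/
def avgCC (n m : ℕ) (rs rd : ℝ) (X : Fin n → ℝ) : ℝ :=
  (1 / (n : ℝ)) * ∑ i : Fin n,
    if 2 ≤ gbmDeg n m rs rd X i then
      localTri n m rs rd X i /
        (gbmDeg n m rs rd X i * (gbmDeg n m rs rd X i - 1))
    else 0


/-! ### Geometry of the circle -/

/-- Neighbourhood indicator for the periodic distance. -/
def nb (r u v : ℝ) : ℝ := if pdist u v ≤ r then 1 else 0

/-- Uniform law on the unit interval. -/
def unif : Measure ℝ := volume.restrict (Set.Icc (0 : ℝ) 1)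

instance unif_prob : IsProbabilityMeasure unif := by
  constructor
  simp [unif]

open Classical in
/-- One-periodic indicator of a ball around the integers. -/
def pw (r t : ℝ) : ℝ := if ∃ z : ℤ, |t - z| ≤ r then 1 else 0

lemma pw_periodic (r : ℝ) : Function.Periodic (pw r) 1 := by
  intro t
  unfold pw
  congr 1
  apply propext
  constructor
  · rintro ⟨z, hz⟩
    refine ⟨z - 1, ?_⟩
    push_cast
    convert hz using 2
    ring
  · rintro ⟨z, hz⟩
    refine ⟨z + 1, ?_⟩
    push_cast
    convert hz using 2
    ring

lemma pw_small {r t : ℝ} (hr : r ≤ 1 / 4) (ht : |t| < 3 / 4) :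
    pw r t = if |t| ≤ r then 1 else 0 := by
  unfold pw
  congr 1
  apply propext
  constructor
  · rintro ⟨z, hz⟩
    have h1 : |(z : ℝ)| < 1 := by
      have := abs_sub_abs_le_abs_sub (z : ℝ) t
      rw [abs_sub_comm] at this
      linarith
    have h2 : z = 0 := by
      have : |z| < 1 := by exact_mod_cast h1
      exact Int.abs_lt_one_iff.mp this
    simpa [h2] using hz
  · intro h
    exact ⟨0, by simpa using h⟩

lemma pdist_comm (u v : ℝ) : pdist u v = pdist v u := by
  unfold pdist
  rw [abs_sub_comm]

lemma nb_comm (r u v : ℝ) : nb r u v = nb r v u := by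
  unfold nb
  rw [pdist_comm]

lemma nb_nonneg (r u v : ℝ) : 0 ≤ nb r u v := by
  unfold nb; split_ifs <;> norm_num

lemma nb_le_one (r u v : ℝ) : nb r u v ≤ 1 := by
  unfold nb; split_ifs <;> norm_num

lemma nb_eq_pw {r x u : ℝ} (hr : r ≤ 1 / 4) (hx : x ∈ Set.Icc (0 : ℝ) 1)
    (hu : u ∈ Set.Icc (0 : ℝ) 1) : nb r x u = pw r (u - x) := by
  obtain ⟨hx0, hx1⟩ := hx
  obtain ⟨hu0, hu1⟩ := hu
  unfold nb pw pdist
  congr 1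
  apply propext
  rw [abs_sub_comm, min_le_iff]
  constructor
  · rintro (h | h)
    · exact ⟨0, by simpa using h⟩
    · rcases le_total 0 (u - x) with h0 | h0
      · refine ⟨1, ?_⟩
        rw [abs_of_nonneg h0] at h
        push_cast
        rw [abs_of_nonpos] <;> linarith
      · refine ⟨-1, ?_⟩
        rw [abs_of_nonpos h0] at h
        push_cast
        rw [abs_of_nonneg] <;> linarith
  · rintro ⟨z, hz⟩
    rw [abs_le] at hz
    have h1 : (z : ℝ) < 2 := by linarith
    have h2 : (-2 : ℝ) < z := by linarith
    have h1' : z < 2 := by exact_mod_cast h1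
    have h2' : -2 < z := by exact_mod_cast h2
    have : z = -1 ∨ z = 0 ∨ z = 1 := by omega
    rcases this with rfl | rfl | rfl
    · right
      push_cast at hz
      have := neg_abs_le (u - x)
      linarith
    · left
      push_cast at hz
      rw [abs_le]
      constructor <;> linarith
    · right
      push_cast at hz
      have := le_abs_self (u - x)
      linarith

lemma integral_shift (Φ : ℝ → ℝ) (hΦ : Function.Periodic Φ 1) (x : ℝ) :
    ∫ u in Set.Icc (0 : ℝ) 1, Φ (u - x) = ∫ u in (-(1 / 2) : ℝ)..(1 / 2), Φ u := by
  rw [integral_Icc_eq_integral_Ioc, ← intervalIntegral.integral_of_le zero_le_one,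
    intervalIntegral.integral_comp_sub_right]
  have := hΦ.intervalIntegral_add_eq (0 - x) (-(1 / 2))
  convert this using 2 <;> ring

lemma integral_cut {r : ℝ} (hr0 : 0 ≤ r) (hr : r ≤ 1 / 4) (f g : ℝ → ℝ)
    (h : ∀ u, |u| ≤ 1 / 2 → f u = if |u| ≤ r then g u else 0) :
    ∫ u in (-(1 / 2) : ℝ)..(1 / 2), f u = ∫ u in (-r)..r, g u := by
  rw [intervalIntegral.integral_of_le (by norm_num), intervalIntegral.integral_of_le (by linarith),
    ← integral_Icc_eq_integral_Ioc, ← integral_Icc_eq_integral_Ioc]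
  have h1 : ∫ u in Set.Icc (-(1 / 2) : ℝ) (1 / 2), f u =
      ∫ u in Set.Icc (-(1 / 2) : ℝ) (1 / 2), (Set.Icc (-r) r).indicator g u := by
    apply setIntegral_congr_fun measurableSet_Icc
    intro u hu
    rw [h u (abs_le.mpr hu), Set.indicator_apply]
    simp [abs_le]
  rw [h1, setIntegral_indicator measurableSet_Icc]
  congr 2
  apply Set.inter_eq_right.mpr
  apply Set.Icc_subset_Icc <;> linarith

lemma inner_len {r2 r3 u : ℝ} (h3 : 0 ≤ r3) :
    ∫ v in (-r3)..r3, (if |v - u| ≤ r2 then (1 : ℝ) else 0) =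
      max (min r3 (u + r2) - max (-r3) (u - r2)) 0 := by
  rw [intervalIntegral.integral_of_le (by linarith), ← integral_Icc_eq_integral_Ioc]
  have h1 : ∫ v in Set.Icc (-r3) r3, (if |v - u| ≤ r2 then (1 : ℝ) else 0) =
      ∫ v in Set.Icc (-r3) r3, (Set.Icc (u - r2) (u + r2)).indicator (fun _ => (1 : ℝ)) v := by
    apply setIntegral_congr_fun measurableSet_Icc
    intro v hv
    simp only
    rw [Set.indicator_apply]
    congr 1
    apply propext
    rw [abs_le, Set.mem_Icc]
    constructor <;> rintro ⟨a, b⟩ <;> constructor <;> linarith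
  rw [h1, setIntegral_indicator measurableSet_Icc, Set.Icc_inter_Icc]
  simp [Measure.real, ENNReal.toReal_ofReal']

lemma integral_nb {r x : ℝ} (hr0 : 0 ≤ r) (hr : r ≤ 1 / 4) (hx : x ∈ Set.Icc (0 : ℝ) 1) :
    ∫ v, nb r x v ∂unif = 2 * r := by
  unfold unif
  have h1 : ∫ v in Set.Icc (0 : ℝ) 1, nb r x v = ∫ v in Set.Icc (0 : ℝ) 1, pw r (v - x) :=
    setIntegral_congr_fun measurableSet_Icc fun v hv => nb_eq_pw hr hx hv
  rw [h1, integral_shift _ (pw_periodic r), integral_cut hr0 hr _ (fun _ => 1)]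
  · simp; ring
  · intro u hu
    exact pw_small hr (by linarith)

/-- Overlap length. -/
def ovl (r2 r3 u : ℝ) : ℝ := max (min r3 (u + r2) - max (-r3) (u - r2)) 0

lemma integral_tri {r1 r2 r3 x : ℝ} (h10 : 0 ≤ r1) (h1 : r1 ≤ 1 / 4) (h2 : r2 ≤ 1 / 4)
    (h30 : 0 ≤ r3) (h3 : r3 ≤ 1 / 4) (hx : x ∈ Set.Icc (0 : ℝ) 1) :
    ∫ u, nb r1 x u * ∫ v, nb r3 x v * nb r2 u v ∂unif ∂unif = ∫ u in (-r1)..r1, ovl r2 r3 u := by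
  set Φ : ℝ → ℝ := fun u => pw r1 u * ∫ v in (-(1 / 2) : ℝ)..(1 / 2), pw r3 v * pw r2 (v - u)
    with hΦ
  have hper : Function.Periodic Φ 1 := by
    intro u
    simp only [hΦ]
    rw [pw_periodic r1 u]
    congr 2
    ext v
    congr 1
    rw [← pw_periodic r2 (v - (u + 1))]
    congr 1
    ring
  have e1 : ∫ u, nb r1 x u * ∫ v, nb r3 x v * nb r2 u v ∂unif ∂unif =
      ∫ u in Set.Icc (0 : ℝ) 1, Φ (u - x) := by
    apply setIntegral_congr_fun measurableSet_Icc
    intro u hu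
    simp only [hΦ]
    rw [nb_eq_pw h1 hx hu]
    congr 1
    rw [← integral_shift (fun v => pw r3 v * pw r2 (v - (u - x))) _ x]
    · apply setIntegral_congr_fun measurableSet_Icc
      intro v hv
      simp only
      rw [nb_eq_pw h3 hx hv, nb_eq_pw h2 hu hv]
      congr 2
      ring
    · intro v
      simp only
      rw [pw_periodic r3 v, ← pw_periodic r2 (v - (u - x))]
      congr 2
      ring
  rw [e1, integral_shift _ hper, integral_cut h10 h1]
  intro u hu
  simp only [hΦ]
  rw [pw_small h1 (by linarith)]
  split_ifs with hur
  · rw [one_mul, ovl, ← inner_len h30, integral_cut h30 h3]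
    intro v hv
    rw [pw_small h3 (by linarith)]
    by_cases hvr : |v| ≤ r3
    · rw [if_pos hvr, if_pos hvr, one_mul, pw_small h2]
      have := abs_sub v u
      linarith
    · rw [if_neg hvr, if_neg hvr, zero_mul]
  · simp

lemma integral_even (F : ℝ → ℝ) (hF : Continuous F) (a : ℝ) :
    ∫ u in (-a)..a, F |u| = 2 * ∫ u in (0 : ℝ)..a, F |u| := by
  have hc : Continuous fun u => F |u| := hF.comp continuous_abs
  rw [← intervalIntegral.integral_add_adjacent_intervals (b := 0)
    (hc.intervalIntegrable _ _) (hc.intervalIntegrable _ _)]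
  have : ∫ u in (-a)..0, F |u| = ∫ u in (0 : ℝ)..a, F |u| := by
    have := intervalIntegral.integral_comp_neg (a := 0) (b := a) (fun u => F |u|)
    simp only [abs_neg, neg_zero] at this
    exact this.symm
  rw [this]; ring

lemma ovl_cont (r2 r3 : ℝ) : Continuous (ovl r2 r3) := by
  unfold ovl; fun_prop

lemma ovl_abs (r2 r3 u : ℝ) : ovl r2 r3 |u| = ovl r2 r3 u := by
  rcases abs_choice u with h | h <;> rw [h]
  unfold ovl
  congr 1
  have e1 : -u + r2 = -(u - r2) := by ring
  have e2 : -u - r2 = -(u + r2) := by ring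
  rw [e1, e2, max_neg_neg]
  have : min r3 (-(u - r2)) = -max (-r3) (u - r2) := by rw [← min_neg_neg, neg_neg]
  rw [this]; ring

lemma integral_ovl (r1 r2 r3 : ℝ) :
    ∫ u in (-r1)..r1, ovl r2 r3 u = 2 * ∫ u in (0 : ℝ)..r1, ovl r2 r3 u := by
  have := integral_even (ovl r2 r3) (ovl_cont r2 r3) r1
  simpa only [ovl_abs] using this

lemma ovl_eq {r2 r3 u : ℝ} (a b : ℝ) (ha : min r3 (u + r2) = a) (hb : max (-r3) (u - r2) = b)
    (hab : b ≤ a) : ovl r2 r3 u = a - b := by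
  unfold ovl
  rw [ha, hb, max_eq_left (by linarith)]

lemma ovl_self {r u : ℝ} (h0 : 0 ≤ u) (hu : u ≤ 2 * r) : ovl r r u = 2 * r - u := by
  rw [ovl_eq r (u - r) (min_eq_left (by linarith)) (max_eq_right (by linarith)) (by linarith)]
  ring

lemma ovl_self_big {r u : ℝ} (_h0 : 0 ≤ u) (hu : 2 * r ≤ u) : ovl r r u = 0 := by
  have h1 : min r (u + r) ≤ r := min_le_left _ _
  have h2 : u - r ≤ max (-r) (u - r) := le_max_right _ _
  exact max_eq_right (by linarith)

lemma integral_aff (c a b : ℝ) : ∫ u in a..b, (c - u) = c * (b - a) - (b ^ 2 - a ^ 2) / 2 := by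
  rw [intervalIntegral.integral_sub (by simp) (by simp)]
  simp
  ring

/-- Common value of the mixed triangle integrals. -/
def mixJ (rs rd : ℝ) : ℝ := if rs < 2 * rd then 4 * rs * rd - rs ^ 2 else 4 * rd ^ 2

lemma tri_sss {r : ℝ} (h : 0 ≤ r) : ∫ u in (-r)..r, ovl r r u = 3 * r ^ 2 := by
  rw [integral_ovl]
  have : ∫ u in (0 : ℝ)..r, ovl r r u = ∫ u in (0 : ℝ)..r, (2 * r - u) := by
    apply intervalIntegral.integral_congr
    intro u hu
    rw [Set.uIcc_of_le h] at hu
    exact ovl_self hu.1 (by linarith [hu.2])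
  rw [this, integral_aff]
  ring

lemma tri_sdd {rs rd : ℝ} (h : 0 < rd) (hsd : rd ≤ rs) :
    ∫ u in (-rs)..rs, ovl rd rd u = mixJ rs rd := by
  rw [integral_ovl]
  unfold mixJ
  split_ifs with hc
  · have : ∫ u in (0 : ℝ)..rs, ovl rd rd u = ∫ u in (0 : ℝ)..rs, (2 * rd - u) := by
      apply intervalIntegral.integral_congr
      intro u hu
      rw [Set.uIcc_of_le (by linarith)] at hu
      exact ovl_self hu.1 (by linarith [hu.2])
    rw [this, integral_aff]
    ring
  · push Not at hc
    rw [← intervalIntegral.integral_add_adjacent_intervals (b := 2 * rd)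
      ((ovl_cont _ _).intervalIntegrable _ _) ((ovl_cont _ _).intervalIntegrable _ _)]
    have e1 : ∫ u in (0 : ℝ)..(2 * rd), ovl rd rd u = ∫ u in (0 : ℝ)..(2 * rd), (2 * rd - u) := by
      apply intervalIntegral.integral_congr
      intro u hu
      rw [Set.uIcc_of_le (by linarith)] at hu
      exact ovl_self hu.1 (by linarith [hu.2])
    have e2 : ∫ u in (2 * rd)..rs, ovl rd rd u = ∫ u in (2 * rd)..rs, (0 : ℝ) := by
      apply intervalIntegral.integral_congr
      intro u hu
      rw [Set.uIcc_of_le (by linarith)] at hu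
      exact ovl_self_big (by linarith [hu.1]) (by linarith [hu.1])
    rw [e1, e2, integral_aff]
    simp
    ring

lemma tri_mix_aux {rs rd : ℝ} (F : ℝ → ℝ) (hF : Continuous F) (h : 0 < rd) (hsd : rd ≤ rs)
    (h1 : ∀ u, 0 ≤ u → u ≤ rd → u ≤ rs - rd → F u = 2 * rd)
    (h2 : ∀ u, 0 ≤ u → u ≤ rd → rs - rd ≤ u → F u = rs + rd - u) :
    2 * ∫ u in (0 : ℝ)..rd, F u = mixJ rs rd := by
  unfold mixJ
  split_ifs with hc
  · rw [← intervalIntegral.integral_add_adjacent_intervals (b := rs - rd)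
      (hF.intervalIntegrable _ _) (hF.intervalIntegrable _ _)]
    have e1 : ∫ u in (0 : ℝ)..(rs - rd), F u = ∫ u in (0 : ℝ)..(rs - rd), (2 * rd) := by
      apply intervalIntegral.integral_congr
      intro u hu
      rw [Set.uIcc_of_le (by linarith)] at hu
      exact h1 u hu.1 (by linarith [hu.2]) hu.2
    have e2 : ∫ u in (rs - rd)..rd, F u = ∫ u in (rs - rd)..rd, (rs + rd - u) := by
      apply intervalIntegral.integral_congr
      intro u hu
      rw [Set.uIcc_of_le (by linarith)] at hu
      exact h2 u (by linarith [hu.1]) hu.2 hu.1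
    rw [e1, e2, integral_aff]
    simp
    ring
  · push Not at hc
    have e1 : ∫ u in (0 : ℝ)..rd, F u = ∫ u in (0 : ℝ)..rd, (2 * rd) := by
      apply intervalIntegral.integral_congr
      intro u hu
      rw [Set.uIcc_of_le (by linarith)] at hu
      exact h1 u hu.1 hu.2 (by linarith [hu.2])
    rw [e1]
    simp
    ring

lemma tri_dds {rs rd : ℝ} (h : 0 < rd) (hsd : rd ≤ rs) :
    ∫ u in (-rd)..rd, ovl rd rs u = mixJ rs rd := by
  rw [integral_ovl]
  apply tri_mix_aux _ (ovl_cont _ _) h hsd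
  · intro u h0 hu h1
    rw [ovl_eq (u + rd) (u - rd) (min_eq_right (by linarith)) (max_eq_right (by linarith))
      (by linarith)]
    ring
  · intro u h0 hu h1
    rw [ovl_eq rs (u - rd) (min_eq_left (by linarith)) (max_eq_right (by linarith))
      (by linarith)]
    ring

lemma tri_dsd {rs rd : ℝ} (h : 0 < rd) (hsd : rd ≤ rs) :
    ∫ u in (-rd)..rd, ovl rs rd u = mixJ rs rd := by
  rw [integral_ovl]
  apply tri_mix_aux _ (ovl_cont _ _) h hsd
  · intro u h0 hu h1
    rw [ovl_eq rd (-rd) (min_eq_left (by linarith)) (max_eq_left (by linarith))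
      (by linarith)]
    ring
  · intro u h0 hu h1
    rw [ovl_eq rd (u - rs) (min_eq_left (by linarith)) (max_eq_right (by linarith))
      (by linarith)]
    ring

/-! ### Probabilistic tools -/

/-- Bounded measurable functions. -/
def BM {α : Type*} [MeasurableSpace α] (f : α → ℝ) : Prop :=
  Measurable f ∧ ∃ B, ∀ x, |f x| ≤ B

section BMlemmas

variable {α : Type*} [MeasurableSpace α] {f g : α → ℝ}

lemma BM.add (hf : BM f) (hg : BM g) : BM fun x => f x + g x := by
  obtain ⟨hf, B, hB⟩ := hf
  obtain ⟨hg, C, hC⟩ := hg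
  exact ⟨hf.add hg, B + C, fun x => (abs_add_le _ _).trans (add_le_add (hB x) (hC x))⟩

lemma BM.sub (hf : BM f) (hg : BM g) : BM fun x => f x - g x := by
  obtain ⟨hf, B, hB⟩ := hf
  obtain ⟨hg, C, hC⟩ := hg
  exact ⟨hf.sub hg, B + C, fun x => (abs_sub _ _).trans (add_le_add (hB x) (hC x))⟩

lemma BM.mul (hf : BM f) (hg : BM g) : BM fun x => f x * g x := by
  obtain ⟨hf, B, hB⟩ := hf
  obtain ⟨hg, C, hC⟩ := hg
  refine ⟨hf.mul hg, B * C, fun x => ?_⟩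
  rw [abs_mul]
  exact mul_le_mul (hB x) (hC x) (abs_nonneg _) ((abs_nonneg _).trans (hB x))

lemma BM.abs (hf : BM f) : BM fun x => |f x| := by
  obtain ⟨hf, B, hB⟩ := hf
  exact ⟨hf.abs, B, fun x => by rw [abs_abs]; exact hB x⟩

lemma BM.pow (hf : BM f) (n : ℕ) : BM fun x => f x ^ n := by
  obtain ⟨hf, B, hB⟩ := hf
  refine ⟨hf.pow_const n, B ^ n, fun x => ?_⟩
  rw [abs_pow]
  exact pow_le_pow_left₀ (abs_nonneg _) (hB x) n

lemma BM.const (c : ℝ) : BM fun _ : α => c := ⟨measurable_const, |c|, fun _ => le_rfl⟩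

lemma BM.comp {β : Type*} [MeasurableSpace β] (hf : BM f) {φ : β → α} (hφ : Measurable φ) :
    BM fun y => f (φ y) := by
  obtain ⟨hf, B, hB⟩ := hf
  exact ⟨hf.comp hφ, B, fun x => hB _⟩

lemma BM.sum {ι : Type*} (s : Finset ι) {F : ι → α → ℝ} (hF : ∀ i, BM (F i)) :
    BM fun x => ∑ i ∈ s, F i x := by
  choose hm B hB using hF
  refine ⟨Finset.measurable_fun_sum s fun i _ => hm i, ∑ i ∈ s, B i, fun x => ?_⟩
  exact (Finset.abs_sum_le_sum_abs _ _).trans (Finset.sum_le_sum fun i _ => hB i x)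

lemma BM.integrable (hf : BM f) (μ : Measure α) [IsFiniteMeasure μ] : Integrable f μ := by
  obtain ⟨hf, B, hB⟩ := hf
  exact Integrable.of_bound hf.aestronglyMeasurable B (Filter.Eventually.of_forall hB)

lemma BM.of01 (hf : Measurable f) (h0 : ∀ x, 0 ≤ f x) (h1 : ∀ x, f x ≤ 1) : BM f :=
  ⟨hf, 1, fun x => by rw [abs_of_nonneg (h0 x)]; exact h1 x⟩

lemma BM.integral_right {β : Type*} [MeasurableSpace β] (μ : Measure β) [IsProbabilityMeasure μ]
    {F : α × β → ℝ} (hF : BM F) : BM fun x => ∫ y, F (x, y) ∂μ := by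
  obtain ⟨hf, B, hB⟩ := hF
  refine ⟨hf.stronglyMeasurable.integral_prod_right'.measurable, B, fun x => ?_⟩
  have := norm_integral_le_of_norm_le_const (μ := μ) (f := fun y => F (x, y)) (C := B)
    (Filter.Eventually.of_forall fun y => hB (x, y))
  simpa using this

end BMlemmas

/-- The sample law. -/
abbrev sampP (n : ℕ) : Measure (Fin n → ℝ) := Measure.pi fun _ => unif

lemma meas_upd {n : ℕ} (i : Fin n) :
    Measurable fun p : ℝ × (Fin n → ℝ) => Function.update p.2 i p.1 := by
  rw [measurable_pi_iff]
  intro j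
  by_cases h : j = i
  · subst h
    simpa using measurable_fst
  · simp only [Function.update_of_ne h]
    fun_prop

lemma map_upd {n : ℕ} (i : Fin n) :
    Measure.map (fun p : ℝ × (Fin n → ℝ) => Function.update p.2 i p.1) (unif.prod (sampP n))
      = sampP n := by
  symm
  apply Measure.pi_eq
  intro s hs
  rw [Measure.map_apply (meas_upd i) (MeasurableSet.univ_pi hs)]
  have : (fun p : ℝ × (Fin n → ℝ) => Function.update p.2 i p.1) ⁻¹' (Set.univ.pi s) =
      s i ×ˢ (Set.univ.pi (Function.update s i Set.univ)) := by
    ext ⟨x, X⟩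
    simp only [Set.mem_preimage, Set.mem_pi, Set.mem_univ, true_imp_iff, Set.mem_prod]
    constructor
    · intro h
      refine ⟨by simpa using h i, fun j => ?_⟩
      by_cases hj : j = i
      · subst hj; simp
      · simpa [Function.update_of_ne hj] using h j
    · rintro ⟨h1, h2⟩ j
      by_cases hj : j = i
      · subst hj; simpa using h1
      · simpa [Function.update_of_ne hj] using h2 j
  rw [this, Measure.prod_prod, Measure.pi_pi, ← Finset.mul_prod_erase _ _ (Finset.mem_univ i),
    ← Finset.mul_prod_erase _ (fun j => unif (s j)) (Finset.mem_univ i)]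
  simp only [Function.update_self, measure_univ, one_mul]
  congr 1
  apply Finset.prod_congr rfl
  intro j hj
  rw [Function.update_of_ne (Finset.ne_of_mem_erase hj)]

lemma integral_upd {n : ℕ} (i : Fin n) {F : (Fin n → ℝ) → ℝ} (hF : BM F) :
    ∫ X, F X ∂sampP n = ∫ x, ∫ X, F (Function.update X i x) ∂sampP n ∂unif := by
  conv_lhs => rw [← map_upd i]
  rw [integral_map (meas_upd i).aemeasurable hF.1.aestronglyMeasurable]
  rw [integral_prod _ ((hF.comp (meas_upd i)).integrable _)]

lemma integral_upd_le {n : ℕ} (i : Fin n) {F : (Fin n → ℝ) → ℝ} (hF : BM F) {c : ℝ → ℝ}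
    (hc : BM c)
    (h : ∀ x ∈ Set.Icc (0 : ℝ) 1, ∫ X, F (Function.update X i x) ∂sampP n ≤ c x) :
    ∫ X, F X ∂sampP n ≤ ∫ x, c x ∂unif := by
  rw [integral_upd i hF]
  apply integral_mono_ae
  · exact ((hF.comp (meas_upd i)).integral_right (sampP n)).integrable _
  · exact hc.integrable _
  · exact (ae_restrict_mem measurableSet_Icc).mono h

lemma integral_coord {n : ℕ} (j : Fin n) {f : ℝ → ℝ} (hf : BM f) :
    ∫ X, f (X j) ∂sampP n = ∫ x, f x ∂unif :=
  integral_comp_eval (μ := fun _ : Fin n => unif) hf.1.aestronglyMeasurable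

lemma var_le {n : ℕ} {c : Fin n → ℝ → ℝ} (hc : ∀ j, BM (c j)) :
    ∫ X, (∑ j, c j (X j) - ∑ j, ∫ x, c j x ∂unif) ^ 2 ∂sampP n ≤ ∑ j, ∫ x, c j x ^ 2 ∂unif := by
  have hL : ∀ j, MemLp (c j) 2 unif := fun j => by
    obtain ⟨hm, B, hB⟩ := hc j
    exact MemLp.of_bound hm.aestronglyMeasurable B (Filter.Eventually.of_forall hB)
  have h1 := ProbabilityTheory.variance_sum_pi (μ := fun _ : Fin n => unif) hL
  have hcoord : ∀ j, BM fun X : Fin n → ℝ => c j (X j) := fun j =>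
    (hc j).comp (measurable_pi_apply j)
  have hsum : BM fun X : Fin n → ℝ => ∑ j, c j (X j) := BM.sum _ hcoord
  have e : (∑ j, fun X : Fin n → ℝ => c j (X j)) = fun X => ∑ j, c j (X j) := by
    ext X; simp
  rw [e, ProbabilityTheory.variance_eq_integral hsum.1.aemeasurable] at h1
  have hmean : ∫ X, ∑ j, c j (X j) ∂sampP n = ∑ j, ∫ x, c j x ∂unif := by
    rw [integral_finsetSum _ fun j _ => (hcoord j).integrable _]
    exact Finset.sum_congr rfl fun j _ => integral_coord j (hc j)
  rw [hmean] at h1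
  rw [h1]
  apply Finset.sum_le_sum
  intro j _
  exact ProbabilityTheory.variance_le_expectation_sq (hc j).1.aestronglyMeasurable

lemma l1_of_l2 {α : Type*} [MeasurableSpace α] {μ : Measure α} [IsProbabilityMeasure μ]
    {f : α → ℝ} (hf : BM f) {s : ℝ} (hs : 0 < s) (h : ∫ x, f x ^ 2 ∂μ ≤ s ^ 2) :
    ∫ x, |f x| ∂μ ≤ s := by
  have h1 : ∫ x, |f x| ∂μ ≤ ∫ x, ((1 / (2 * s)) * f x ^ 2 + s / 2) ∂μ := by
    apply integral_mono (hf.abs.integrable _)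
      ((((BM.const _).mul (hf.pow 2)).add (BM.const _)).integrable _)
    intro x
    have : 0 ≤ (|f x| - s) ^ 2 / (2 * s) := by positivity
    have e : (|f x| - s) ^ 2 / (2 * s) = (1 / (2 * s)) * f x ^ 2 + s / 2 - |f x| := by
      rw [sub_sq, sq_abs]
      field_simp
      ring
    simp only
    linarith
  rw [integral_add (((BM.const _).mul (hf.pow 2)).integrable _) ((BM.const _).integrable _),
    integral_const_mul] at h1
  simp only [integral_const, probReal_univ, one_smul] at h1
  have h2 : 1 / (2 * s) * ∫ x, f x ^ 2 ∂μ ≤ 1 / (2 * s) * s ^ 2 :=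
    mul_le_mul_of_nonneg_left h (by positivity)
  have h3 : 1 / (2 * s) * s ^ 2 = s / 2 := by field_simp
  linarith

lemma dev_le {n : ℕ} {c : Fin n → ℝ → ℝ} (hc : ∀ j, BM (c j)) {s : ℝ} (hs : 0 < s)
    (h : ∑ j, ∫ x, c j x ^ 2 ∂unif ≤ s ^ 2) :
    ∫ X, |∑ j, c j (X j) - ∑ j, ∫ x, c j x ∂unif| ∂sampP n ≤ s := by
  apply l1_of_l2 _ hs ((var_le hc).trans h)
  exact (BM.sum _ fun j => (hc j).comp (measurable_pi_apply j)).sub (BM.const _)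

/-- Concentration of the second-order statistic. -/
lemma tri_dev {n : ℕ} {b : Fin n → ℝ → ℝ} {h : Fin n → Fin n → ℝ × ℝ → ℝ} {l : ℝ}
    (hb : ∀ j, BM (b j)) (b0 : ∀ j x, 0 ≤ b j x) (b1 : ∀ j x, b j x ≤ 1)
    (hh : ∀ j k, BM (h j k)) (h0 : ∀ j k p, 0 ≤ h j k p) (h1 : ∀ j k p, h j k p ≤ 1)
    (hl : 0 < l) (hbl : ∑ j, ∫ x, b j x ∂unif = l) :
    ∫ X, |∑ j, ∑ k, b j (X j) * (b k (X k) * h j k (X j, X k)) -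
      ∑ j, ∑ k, ∫ u, b j u * ∫ v, b k v * h j k (u, v) ∂unif ∂unif| ∂sampP n
      ≤ l + 2 * (l * √l) := by
  have hbX : ∀ j, BM fun X : Fin n → ℝ => b j (X j) := fun j =>
    (hb j).comp (measurable_pi_apply j)
  have hbh2 : ∀ j k, BM fun p : ℝ × ℝ => b k p.2 * h j k p := fun j k =>
    ((hb k).comp measurable_snd).mul (hh j k)
  have hsl : 0 < √l := Real.sqrt_pos.mpr hl
  set p : Fin n → ℝ → ℝ := fun j y => ∑ k, ∫ v, b k v * h j k (y, v) ∂unif with hp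
  have pBM : ∀ j, BM (p j) := fun j => BM.sum _ fun k => (hbh2 j k).integral_right unif
  have hbhy : ∀ j k y, BM fun v : ℝ => b k v * h j k (y, v) := fun j k y =>
    (hb k).mul ((hh j k).comp (by fun_prop))
  have p0 : ∀ j y, 0 ≤ p j y := fun j y => Finset.sum_nonneg fun k _ =>
    integral_nonneg fun v => mul_nonneg (b0 _ _) (h0 _ _ _)
  have pl : ∀ j y, p j y ≤ l := fun j y => by
    rw [← hbl]
    apply Finset.sum_le_sum
    intro k _
    apply integral_mono ((hbhy j k y).integrable _) ((hb k).integrable _)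
    intro v
    exact mul_le_of_le_one_right (b0 _ _) (h1 _ _ _)
  set S : Fin n → (Fin n → ℝ) → ℝ → ℝ := fun j X y => ∑ k, b k (X k) * h j k (y, X k) with hS
  have SBM : ∀ j, BM fun X : Fin n → ℝ => S j X (X j) := fun j => BM.sum _ fun k =>
    (hbX k).mul ((hh j k).comp (by fun_prop))
  have SyBM : ∀ j y, BM fun X : Fin n → ℝ => S j X y := fun j y => BM.sum _ fun k =>
    (hbX k).mul ((hh j k).comp (by fun_prop))
  have pX : ∀ j, BM fun X : Fin n → ℝ => p j (X j) := fun j =>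
    (pBM j).comp (measurable_pi_apply j)
  have hm : ∑ j, ∑ k, ∫ u, b j u * ∫ v, b k v * h j k (u, v) ∂unif ∂unif =
      ∑ j, ∫ u, b j u * p j u ∂unif := by
    apply Finset.sum_congr rfl
    intro j _
    rw [← integral_finsetSum]
    · simp only [hp, Finset.mul_sum]
    · intro k _
      exact ((hb j).mul ((hbh2 j k).integral_right unif)).integrable _
  rw [hm]
  have FBM : ∀ j, BM fun X : Fin n → ℝ => b j (X j) * |S j X (X j) - p j (X j)| := fun j =>
    (hbX j).mul ((SBM j).sub (pX j)).abs
  have GBM : BM fun X : Fin n → ℝ =>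
      |∑ j, b j (X j) * p j (X j) - ∑ j, ∫ u, b j u * p j u ∂unif| :=
    ((BM.sum _ fun j => (hbX j).mul (pX j)).sub (BM.const _)).abs
  -- first stage
  have st1 : ∀ j, ∫ X, b j (X j) * |S j X (X j) - p j (X j)| ∂sampP n ≤
      (1 + √l) * ∫ x, b j x ∂unif := by
    intro j
    rw [← integral_const_mul]
    apply integral_upd_le j (FBM j) ((BM.const _).mul (hb j))
    intro y _
    have q1 : ∫ X, |S j X y - p j y| ∂sampP n ≤ √l := by
      apply dev_le (fun k => hbhy j k y) hsl
      rw [Real.sq_sqrt hl.le, ← hbl]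
      apply Finset.sum_le_sum
      intro k _
      apply integral_mono (((hbhy j k y).pow 2).integrable _) ((hb k).integrable _)
      intro v
      have a1 := b0 k v
      have a2 := b1 k v
      have a3 := h0 j k (y, v)
      have a4 := h1 j k (y, v)
      have a5 : b k v * h j k (y, v) ≤ b k v := mul_le_of_le_one_right a1 a4
      have a6 : 0 ≤ b k v * h j k (y, v) := mul_nonneg a1 a3
      simp only
      nlinarith
    have q2 : ∀ X : Fin n → ℝ, |S j (Function.update X j y) y - p j y| ≤
        1 + |S j X y - p j y| := by
      intro X
      have : |S j (Function.update X j y) y - S j X y| ≤ 1 := by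
        simp only [hS]
        rw [← Finset.sum_sub_distrib, Finset.sum_eq_single j]
        · rw [Function.update_self, abs_le]
          have a1 := b0 j y
          have a2 := b1 j y
          have a3 := h0 j j (y, y)
          have a4 := h1 j j (y, y)
          have c1 := b0 j (X j)
          have c2 := b1 j (X j)
          have c3 := h0 j j (y, X j)
          have c4 := h1 j j (y, X j)
          have a5 := mul_le_one₀ a2 a3 a4
          have c5 := mul_le_one₀ c2 c3 c4
          have a6 := mul_nonneg a1 a3
          have c6 := mul_nonneg c1 c3
          constructor <;> linarith
        · intro k _ hk
          rw [Function.update_of_ne hk, sub_self]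
        · simp
      calc _ = |(S j (Function.update X j y) y - S j X y) + (S j X y - p j y)| := by
            congr 1; ring
        _ ≤ _ := (abs_add_le _ _).trans (by linarith)
    have q3 : BM fun X : Fin n → ℝ => |S j X y - p j y| := ((SyBM j y).sub (BM.const _)).abs
    calc ∫ X, b j (Function.update X j y j) * |S j (Function.update X j y)
            (Function.update X j y j) - p j (Function.update X j y j)| ∂sampP n
        ≤ ∫ X, b j y * (1 + |S j X y - p j y|) ∂sampP n := by
          apply integral_mono
          · exact ((FBM j).comp ((meas_upd j).comp (measurable_const.prodMk measurable_id))).integrable _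
          · exact ((BM.const _).mul ((BM.const _).add q3)).integrable _
          · intro X
            simp only [Function.update_self]
            exact mul_le_mul_of_nonneg_left (q2 X) (b0 _ _)
      _ = b j y * (1 + ∫ X, |S j X y - p j y| ∂sampP n) := by
          rw [integral_const_mul, integral_add ((BM.const _).integrable _) (q3.integrable _)]
          simp
      _ ≤ b j y * (1 + √l) := mul_le_mul_of_nonneg_left (by linarith) (b0 _ _)
      _ = (1 + √l) * b j y := mul_comm _ _
  -- second stage
  have st2 : ∫ X, |∑ j, b j (X j) * p j (X j) - ∑ j, ∫ u, b j u * p j u ∂unif| ∂sampP n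
      ≤ l * √l := by
    apply dev_le (fun j => (hb j).mul (pBM j)) (by positivity)
    rw [mul_pow, Real.sq_sqrt hl.le]
    calc ∑ j, ∫ x, (b j x * p j x) ^ 2 ∂unif ≤ ∑ j, ∫ x, l ^ 2 * b j x ∂unif := by
          apply Finset.sum_le_sum
          intro j _
          apply integral_mono ((((hb j).mul (pBM j)).pow 2).integrable _)
            (((BM.const _).mul (hb j)).integrable _)
          intro x
          simp only
          have a1 := b0 j x
          have a2 := b1 j x
          have a3 : p j x ^ 2 ≤ l ^ 2 := pow_le_pow_left₀ (p0 j x) (pl j x) 2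
          have a4 : b j x ^ 2 ≤ b j x := by nlinarith
          rw [mul_pow, mul_comm]
          exact mul_le_mul a3 a4 (by positivity) (by positivity)
      _ = l ^ 2 * l := by
          simp_rw [integral_const_mul]
          rw [← Finset.mul_sum, hbl]
  calc _ ≤ ∫ X, (∑ j, b j (X j) * |S j X (X j) - p j (X j)| +
        |∑ j, b j (X j) * p j (X j) - ∑ j, ∫ u, b j u * p j u ∂unif|) ∂sampP n := by
        apply integral_mono
        · refine BM.integrable (BM.abs (BM.sub (BM.sum _ fun j => BM.sum _ fun k => ?_)
            (BM.const _))) _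
          exact (hbX j).mul ((hbX k).mul ((hh j k).comp (by fun_prop)))
        · exact ((BM.sum _ FBM).add GBM).integrable _
        · intro X
          simp only
          have e : ∑ j, ∑ k, b j (X j) * (b k (X k) * h j k (X j, X k)) -
              ∑ j, ∫ u, b j u * p j u ∂unif =
              ∑ j, b j (X j) * (S j X (X j) - p j (X j)) +
              (∑ j, b j (X j) * p j (X j) - ∑ j, ∫ u, b j u * p j u ∂unif) := by
            simp only [← Finset.mul_sum, mul_sub, Finset.sum_sub_distrib, hS]
            ring
          rw [e]
          refine (abs_add_le _ _).trans (add_le_add ?_ le_rfl)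
          refine (Finset.abs_sum_le_sum_abs _ _).trans (Finset.sum_le_sum fun j _ => ?_)
          rw [abs_mul, abs_of_nonneg (b0 _ _)]
    _ = ∑ j, ∫ X, b j (X j) * |S j X (X j) - p j (X j)| ∂sampP n +
        ∫ X, |∑ j, b j (X j) * p j (X j) - ∑ j, ∫ u, b j u * p j u ∂unif| ∂sampP n := by
        rw [integral_add ((BM.sum _ FBM).integrable _) (GBM.integrable _),
          integral_finsetSum _ fun j _ => (FBM j).integrable _]
    _ ≤ ∑ j, (1 + √l) * ∫ x, b j x ∂unif + l * √l :=
        add_le_add (Finset.sum_le_sum fun j _ => st1 j) st2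
    _ = l + 2 * (l * √l) := by
        rw [← Finset.mul_sum, hbl]
        ring

/-! ### Local clustering coefficients -/

/-- Radius used by a pair of vertices. -/
def sr (n m : ℕ) (rs rd : ℝ) (i j : Fin n) : ℝ :=
  if ((i : ℕ) < m ↔ (j : ℕ) < m) then rs else rd

/-- Local clustering coefficient. -/
def locC (n m : ℕ) (rs rd : ℝ) (X : Fin n → ℝ) (i : Fin n) : ℝ :=
  if 2 ≤ gbmDeg n m rs rd X i then
      localTri n m rs rd X i /
        (gbmDeg n m rs rd X i * (gbmDeg n m rs rd X i - 1))
    else 0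

lemma gbmA_eq (n m : ℕ) (rs rd : ℝ) (X : Fin n → ℝ) (i j : Fin n) :
    gbmA n m rs rd X i j = if i = j then 0 else nb (sr n m rs rd i j) (X i) (X j) := by
  unfold gbmA nb sr
  by_cases h : ((i : ℕ) < m ↔ (j : ℕ) < m) <;> simp [h]

lemma meas_nb (r : ℝ) : Measurable fun p : ℝ × ℝ => nb r p.1 p.2 := by
  unfold nb pdist
  apply Measurable.ite _ measurable_const measurable_const
  apply measurableSet_le
  · fun_prop
  · fun_prop

lemma nb_BM (r : ℝ) : BM fun p : ℝ × ℝ => nb r p.1 p.2 :=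
  BM.of01 (meas_nb r) (fun _ => nb_nonneg _ _ _) (fun _ => nb_le_one _ _ _)

lemma gbmA_BM (n m : ℕ) (rs rd : ℝ) (i j : Fin n) : BM fun X => gbmA n m rs rd X i j := by
  simp only [gbmA_eq]
  by_cases h : i = j
  · simp only [h, if_true]
    exact BM.const 0
  · simp only [h, if_false]
    exact (nb_BM (sr n m rs rd i j)).comp (φ := fun X : Fin n → ℝ => (X i, X j)) (by fun_prop)

lemma gbmA_nonneg (n m : ℕ) (rs rd : ℝ) (X : Fin n → ℝ) (i j : Fin n) :
    0 ≤ gbmA n m rs rd X i j := by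
  rw [gbmA_eq]
  split_ifs
  · exact le_rfl
  · exact nb_nonneg _ _ _

lemma gbmA_le_one (n m : ℕ) (rs rd : ℝ) (X : Fin n → ℝ) (i j : Fin n) :
    gbmA n m rs rd X i j ≤ 1 := by
  rw [gbmA_eq]
  split_ifs
  · exact zero_le_one
  · exact nb_le_one _ _ _

lemma sr_comm (n m : ℕ) (rs rd : ℝ) (i j : Fin n) : sr n m rs rd i j = sr n m rs rd j i := by
  unfold sr
  simp only [Iff.comm]

lemma gbmA_comm (n m : ℕ) (rs rd : ℝ) (X : Fin n → ℝ) (i j : Fin n) :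
    gbmA n m rs rd X i j = gbmA n m rs rd X j i := by
  rw [gbmA_eq, gbmA_eq, nb_comm, sr_comm]
  simp only [eq_comm]

lemma localTri_nonneg (n m : ℕ) (rs rd : ℝ) (X : Fin n → ℝ) (i : Fin n) :
    0 ≤ localTri n m rs rd X i := by
  unfold localTri
  refine Finset.sum_nonneg fun j _ => Finset.sum_nonneg fun k _ => ?_
  split_ifs
  · exact mul_nonneg (mul_nonneg (gbmA_nonneg ..) (gbmA_nonneg ..)) (gbmA_nonneg ..)
  · exact le_rfl

lemma localTri_le (n m : ℕ) (rs rd : ℝ) (X : Fin n → ℝ) (i : Fin n) :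
    localTri n m rs rd X i ≤ gbmDeg n m rs rd X i ^ 2 := by
  unfold localTri gbmDeg
  rw [sq, Finset.sum_mul_sum]
  refine Finset.sum_le_sum fun j _ => Finset.sum_le_sum fun k _ => ?_
  have a1 := gbmA_nonneg n m rs rd X i j
  have a2 := gbmA_nonneg n m rs rd X i k
  split_ifs
  · rw [gbmA_comm n m rs rd X k i]
    exact mul_le_mul_of_nonneg_right (mul_le_of_le_one_right a1 (gbmA_le_one ..)) a2
  · positivity

lemma gbmDeg_nonneg (n m : ℕ) (rs rd : ℝ) (X : Fin n → ℝ) (i : Fin n) :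
    0 ≤ gbmDeg n m rs rd X i := Finset.sum_nonneg fun _ _ => gbmA_nonneg ..

lemma cc_bound {T d : ℝ} (hT : 0 ≤ T) (hTd : T ≤ d ^ 2) :
    0 ≤ (if 2 ≤ d then T / (d * (d - 1)) else 0) ∧
      (if 2 ≤ d then T / (d * (d - 1)) else 0) ≤ 2 := by
  split_ifs with h
  · have h1 : 0 < d * (d - 1) := mul_pos (by linarith) (by linarith)
    refine ⟨div_nonneg hT h1.le, ?_⟩
    rw [div_le_iff₀ h1]
    nlinarith
  · norm_num

lemma locC_BM (n m : ℕ) (rs rd : ℝ) (i : Fin n) : BM fun X => locC n m rs rd X i := by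
  have hd : Measurable fun X => gbmDeg n m rs rd X i :=
    (BM.sum Finset.univ fun j => gbmA_BM n m rs rd i j).1
  have ht : Measurable fun X => localTri n m rs rd X i := by
    refine (BM.sum Finset.univ fun j => BM.sum Finset.univ fun k => ?_).1
    by_cases h : j ≠ i ∧ k ≠ i ∧ j ≠ k
    · simp only [h, if_true, not_false_eq_true, ne_eq, and_self]
      exact ((gbmA_BM n m rs rd i j).mul (gbmA_BM n m rs rd j k)).mul (gbmA_BM n m rs rd k i)
    · simp only [h, if_false]
      exact BM.const 0
  refine ⟨?_, 2, fun X => ?_⟩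
  · unfold locC
    apply Measurable.ite (measurableSet_le measurable_const hd) _ measurable_const
    fun_prop
  · have := cc_bound (localTri_nonneg n m rs rd X i) (localTri_le n m rs rd X i)
    unfold locC
    rw [abs_of_nonneg this.1]
    exact this.2

lemma cc_pointwise {T T' d d' l M : ℝ} (hl : 8 ≤ l) (hM0 : 0 ≤ M) (hM1 : M ≤ 1) (hT : 0 ≤ T)
    (hTT : T ≤ T') (hTT' : T' ≤ T + 3 * d') (hTd : T ≤ d ^ 2) (hd : 0 ≤ d) (hdd : d ≤ d')
    (hdd' : d' ≤ d + 1) :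
    |(if 2 ≤ d then T / (d * (d - 1)) else 0) - M| ≤
      16 / l ^ 2 * (|T' - M * l ^ 2| + ((d' - l) ^ 2 + 2 * l * |d' - l|) + (6 * d' + 2)) +
        8 / l ^ 2 * (d' - l) ^ 2 := by
  by_cases hc : l / 2 ≤ d'
  · have hd1 : l / 2 - 1 ≤ d := by linarith
    have hD : l ^ 2 / 16 ≤ d * (d - 1) := by nlinarith
    have hl2 : 0 < l ^ 2 := by positivity
    have hDpos : 0 < d * (d - 1) := by linarith [show 0 < l ^ 2 / 16 by positivity]
    rw [if_pos (by linarith)]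
    have e : T / (d * (d - 1)) - M = (T - M * (d * (d - 1))) / (d * (d - 1)) := by
      rw [sub_div, mul_div_cancel_right₀ _ hDpos.ne']
    have hA : |d * (d - 1) - l ^ 2| ≤ (d' - l) ^ 2 + 2 * l * |d' - l| + (3 * d' + 2) := by
      have g1 := le_abs_self (d' - l)
      have g2 := neg_abs_le (d' - l)
      have g3 : 0 ≤ |d' - l| := abs_nonneg _
      have e1 : d' ^ 2 - l ^ 2 = (d' - l) ^ 2 + 2 * l * (d' - l) := by ring
      have g4 : l * (d' - l) ≤ l * |d' - l| := mul_le_mul_of_nonneg_left g1 (by linarith)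
      have g5 : l * (-|d' - l|) ≤ l * (d' - l) := mul_le_mul_of_nonneg_left g2 (by linarith)
      have g6 : d ^ 2 ≤ d' ^ 2 := pow_le_pow_left₀ hd hdd 2
      have g7 : d' ^ 2 ≤ d ^ 2 + 2 * d' := by nlinarith
      have g8 : 0 ≤ (d' - l) ^ 2 := sq_nonneg _
      rw [abs_le]
      constructor <;> nlinarith
    have hN : |T - M * (d * (d - 1))| ≤
        |T' - M * l ^ 2| + ((d' - l) ^ 2 + 2 * l * |d' - l|) + (6 * d' + 2) := by
      have e2 : T - M * (d * (d - 1)) =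
          (T' - M * l ^ 2) + ((T - T') + -(M * (d * (d - 1) - l ^ 2))) := by ring
      have k1 : |T - T'| ≤ 3 * d' := by rw [abs_le]; constructor <;> linarith
      have k2 : |-(M * (d * (d - 1) - l ^ 2))| ≤ |d * (d - 1) - l ^ 2| := by
        rw [abs_neg, abs_mul, abs_of_nonneg hM0]
        exact mul_le_of_le_one_left (abs_nonneg _) hM1
      rw [e2]
      have k3 := abs_add_le (T' - M * l ^ 2) ((T - T') + -(M * (d * (d - 1) - l ^ 2)))
      have k4 := abs_add_le (T - T') (-(M * (d * (d - 1) - l ^ 2)))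
      linarith
    rw [e, abs_div, abs_of_pos hDpos]
    have hfin : |T - M * (d * (d - 1))| / (d * (d - 1)) ≤
        (|T' - M * l ^ 2| + ((d' - l) ^ 2 + 2 * l * |d' - l|) + (6 * d' + 2)) / (l ^ 2 / 16) :=
      div_le_div₀ ((abs_nonneg _).trans hN) hN (by positivity) hD
    have e3 : ∀ z : ℝ, z / (l ^ 2 / 16) = 16 / l ^ 2 * z := by
      intro z; field_simp
    rw [e3] at hfin
    have : 0 ≤ 8 / l ^ 2 * (d' - l) ^ 2 := by positivity
    linarith
  · push Not at hc
    obtain ⟨c0, c2⟩ := cc_bound hT hTd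
    have h1 : |(if 2 ≤ d then T / (d * (d - 1)) else 0) - M| ≤ 2 := by
      rw [abs_le]; constructor <;> linarith
    have h2 : 2 ≤ 8 / l ^ 2 * (d' - l) ^ 2 := by
      have : l ^ 2 / 4 ≤ (d' - l) ^ 2 := by nlinarith
      calc (2 : ℝ) = 8 / l ^ 2 * (l ^ 2 / 4) := by field_simp; norm_num
        _ ≤ _ := mul_le_mul_of_nonneg_left this (by positivity)
    have h3 : 0 ≤ 16 / l ^ 2 * (|T' - M * l ^ 2| + ((d' - l) ^ 2 + 2 * l * |d' - l|) +
        (6 * d' + 2)) := by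
      have : 0 ≤ d' := hd.trans hdd
      have : 0 ≤ l := by linarith
      positivity
    linarith

lemma sum_type (k : ℕ) (f : Prop → ℝ) :
    ∑ j : Fin (2 * k), f ((j : ℕ) < k) = k * (f True + f False) := by
  rw [Fin.sum_univ_eq_sum_range (fun j => f (j < k)) (2 * k), two_mul, Finset.sum_range_add]
  have e1 : ∑ x ∈ Finset.range k, f (x < k) = ∑ x ∈ Finset.range k, f True :=
    Finset.sum_congr rfl fun x hx => by simp [Finset.mem_range.mp hx]
  have e2 : ∑ x ∈ Finset.range k, f (k + x < k) = ∑ x ∈ Finset.range k, f False :=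
    Finset.sum_congr rfl fun x _ => by simp
  rw [e1, e2]
  simp
  ring

section Vertex

variable {k : ℕ} {rs rd : ℝ}

lemma sr_pos (hrd : 0 < rd) (hds : rd ≤ rs) (i j : Fin (2 * k)) :
    0 ≤ sr (2 * k) k rs rd i j := by
  unfold sr; split_ifs <;> linarith

lemma sr_le (hds : rd ≤ rs) (hs4 : rs ≤ 1 / 4) (i j : Fin (2 * k)) :
    sr (2 * k) k rs rd i j ≤ 1 / 4 := by
  unfold sr; split_ifs <;> linarith

lemma sum_sr (i : Fin (2 * k)) : ∑ j, 2 * sr (2 * k) k rs rd i j = 2 * k * (rs + rd) := by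
  classical
  unfold sr
  have := sum_type k (fun p => 2 * if ((i : ℕ) < k ↔ p) then rs else rd)
  convert this using 1
  · congr!
  by_cases h : (i : ℕ) < k <;> simp [h] <;> ring

/-- The triangle integral. -/
def triJ (r1 r2 r3 : ℝ) : ℝ := ∫ u in (-r1)..r1, ovl r2 r3 u

lemma sum_tri (hrd : 0 < rd) (hds : rd ≤ rs) (i : Fin (2 * k)) :
    ∑ j, ∑ l, triJ (sr (2 * k) k rs rd i j) (sr (2 * k) k rs rd j l) (sr (2 * k) k rs rd i l) =
      k ^ 2 * (3 * rs ^ 2 + 3 * mixJ rs rd) := by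
  classical
  have s1 : triJ rs rs rs = 3 * rs ^ 2 := tri_sss (by linarith)
  have s2 : triJ rs rd rd = mixJ rs rd := tri_sdd hrd hds
  have s3 : triJ rd rd rs = mixJ rs rd := tri_dds hrd hds
  have s4 : triJ rd rs rd = mixJ rs rd := tri_dsd hrd hds
  unfold sr
  obtain ⟨F, hF⟩ : ∃ F : Prop → ℝ, F = fun p : Prop =>
      k * (triJ (if ((i : ℕ) < k ↔ p) then rs else rd)
      (if (p ↔ True) then rs else rd) (if ((i : ℕ) < k ↔ True) then rs else rd) +
      triJ (if ((i : ℕ) < k ↔ p) then rs else rd)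
      (if (p ↔ False) then rs else rd) (if ((i : ℕ) < k ↔ False) then rs else rd)) := ⟨_, rfl⟩
  have h2 : ∀ j : Fin (2 * k), ∑ l : Fin (2 * k),
      triJ (if ((i : ℕ) < k ↔ (j : ℕ) < k) then rs else rd)
      (if ((j : ℕ) < k ↔ (l : ℕ) < k) then rs else rd)
      (if ((i : ℕ) < k ↔ (l : ℕ) < k) then rs else rd) = F ((j : ℕ) < k) := by
    rw [hF]
    intro j
    have := sum_type k (fun q => triJ (if ((i : ℕ) < k ↔ (j : ℕ) < k) then rs else rd)
      (if ((j : ℕ) < k ↔ q) then rs else rd) (if ((i : ℕ) < k ↔ q) then rs else rd))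
    convert this using 1
    · congr!
    · congr!
  refine (Finset.sum_congr rfl fun j _ => h2 j).trans ((sum_type k F).trans ?_)
  rw [hF]
  by_cases h : (i : ℕ) < k <;> simp [h, s1, s2, s3, s4] <;> ring

/-- The limit value. -/
def limM (rs rd : ℝ) : ℝ := (3 * rs ^ 2 + 3 * mixJ rs rd) / (4 * (rs + rd) ^ 2)

lemma limM_nonneg (hrd : 0 < rd) (hds : rd ≤ rs) : 0 ≤ limM rs rd := by
  unfold limM mixJ
  apply div_nonneg _ (by positivity)
  split_ifs <;> nlinarith

lemma limM_le_one (hrd : 0 < rd) (hds : rd ≤ rs) : limM rs rd ≤ 1 := by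
  unfold limM mixJ
  rw [div_le_one (by have : 0 < rs + rd := by linarith
                     positivity)]
  split_ifs <;> nlinarith [sq_nonneg (rs - rd), sq_nonneg (rs - 2 * rd)]

lemma vertex_bound (hrd : 0 < rd) (hds : rd ≤ rs) (hs4 : rs ≤ 1 / 4) {l : ℝ}
    (hl : l = 2 * k * (rs + rd)) (hl8 : 8 ≤ l) (i : Fin (2 * k)) {x : ℝ}
    (hx : x ∈ Set.Icc (0 : ℝ) 1) :
    ∫ X, |locC (2 * k) k rs rd (Function.update X i x) i - limM rs rd| ∂sampP (2 * k) ≤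
      232 / √l := by
  set s := sr (2 * k) k rs rd with hs
  set b : Fin (2 * k) → ℝ → ℝ := fun j u => nb (s i j) x u with hb
  set h : Fin (2 * k) → Fin (2 * k) → ℝ × ℝ → ℝ := fun j q p => nb (s j q) p.1 p.2 with hh
  have bBM : ∀ j, BM (b j) := fun j => (nb_BM (s i j)).comp (φ := fun u => (x, u)) (by fun_prop)
  have b0 : ∀ j u, 0 ≤ b j u := fun j u => nb_nonneg _ _ _
  have b1 : ∀ j u, b j u ≤ 1 := fun j u => nb_le_one _ _ _
  have hBM : ∀ j q, BM (h j q) := fun j q => nb_BM (s j q)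
  have h0 : ∀ j q p, 0 ≤ h j q p := fun j q p => nb_nonneg _ _ _
  have h1 : ∀ j q p, h j q p ≤ 1 := fun j q p => nb_le_one _ _ _
  have hlpos : 0 < l := by linarith
  have hsl : 0 < √l := Real.sqrt_pos.mpr hlpos
  have hbl : ∑ j, ∫ u, b j u ∂unif = l := by
    rw [hl, ← sum_sr i]
    exact Finset.sum_congr rfl fun j _ => integral_nb (sr_pos hrd hds i j) (sr_le hds hs4 i j) hx
  have hm : ∑ j, ∑ q, ∫ u, b j u * ∫ v, b q v * h j q (u, v) ∂unif ∂unif =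
      limM rs rd * l ^ 2 := by
    have e : limM rs rd * l ^ 2 = k ^ 2 * (3 * rs ^ 2 + 3 * mixJ rs rd) := by
      unfold limM
      rw [hl]
      have : 0 < rs + rd := by linarith
      field_simp
      ring
    rw [e, ← sum_tri hrd hds i]
    refine Finset.sum_congr rfl fun j _ => Finset.sum_congr rfl fun q _ => ?_
    exact integral_tri (sr_pos hrd hds i j) (sr_le hds hs4 i j) (sr_le hds hs4 j q)
      (sr_pos hrd hds i q) (sr_le hds hs4 i q) hx
  have htri := tri_dev bBM b0 b1 hBM h0 h1 hlpos hbl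
  rw [hm] at htri
  have hbX : ∀ j, BM fun X : Fin (2 * k) → ℝ => b j (X j) := fun j =>
    (bBM j).comp (measurable_pi_apply j)
  have hsq : ∑ j, ∫ u, b j u ^ 2 ∂unif ≤ l := by
    rw [← hbl]
    refine Finset.sum_le_sum fun j _ => ?_
    apply integral_mono (((bBM j).pow 2).integrable _) ((bBM j).integrable _)
    intro u
    have := b0 j u
    have := b1 j u
    simp only
    nlinarith
  have hvar := (var_le bBM).trans hsq
  have hdev := dev_le bBM hsl (hsq.trans_eq (Real.sq_sqrt hlpos.le).symm)
  rw [hbl] at hvar hdev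
  set D : (Fin (2 * k) → ℝ) → ℝ := fun X => ∑ j, b j (X j) with hD
  set T : (Fin (2 * k) → ℝ) → ℝ := fun X => ∑ j, ∑ q, b j (X j) * (b q (X q) * h j q (X j, X q))
    with hT
  have DBM : BM D := BM.sum _ hbX
  have TBM : BM T := BM.sum _ fun j => BM.sum _ fun q =>
    (hbX j).mul ((hbX q).mul ((hBM j q).comp (by fun_prop)))
  have hmean : ∫ X, D X ∂sampP (2 * k) = l := by
    rw [← hbl, integral_finsetSum _ fun j _ => (hbX j).integrable _]
    exact Finset.sum_congr rfl fun j _ => integral_coord j (bBM j)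
  have hpt : ∀ X, |locC (2 * k) k rs rd (Function.update X i x) i - limM rs rd| ≤
      16 / l ^ 2 * (|T X - limM rs rd * l ^ 2| + ((D X - l) ^ 2 + 2 * l * |D X - l|) +
        (6 * D X + 2)) + 8 / l ^ 2 * (D X - l) ^ 2 := by
    intro X
    have eA : ∀ j, gbmA (2 * k) k rs rd (Function.update X i x) i j =
        if i = j then 0 else b j (X j) := by
      intro j
      rw [gbmA_eq]
      by_cases hij : i = j
      · simp [hij]
      · rw [if_neg hij, if_neg hij, Function.update_self, Function.update_of_ne (Ne.symm hij)]
    have eT : ∀ j q, (if j ≠ i ∧ q ≠ i ∧ j ≠ q then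
        gbmA (2 * k) k rs rd (Function.update X i x) i j *
        gbmA (2 * k) k rs rd (Function.update X i x) j q *
        gbmA (2 * k) k rs rd (Function.update X i x) q i else 0) =
        if j ≠ i ∧ q ≠ i ∧ j ≠ q then b j (X j) * (b q (X q) * h j q (X j, X q)) else 0 := by
      intro j q
      split_ifs with hc
      · obtain ⟨c1, c2, c3⟩ := hc
        rw [gbmA_comm _ _ _ _ _ q i, eA, eA, gbmA_eq, if_neg c3, if_neg (Ne.symm c1),
          if_neg (Ne.symm c2), Function.update_of_ne c1, Function.update_of_ne c2]
        simp only [hh]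
        ring
      · rfl
    have t0 : ∀ j q, 0 ≤ b j (X j) * (b q (X q) * h j q (X j, X q)) := fun j q =>
      mul_nonneg (b0 _ _) (mul_nonneg (b0 _ _) (h0 _ _ _))
    have t1 : ∀ j q, b j (X j) * (b q (X q) * h j q (X j, X q)) ≤ b q (X q) := fun j q =>
      (mul_le_of_le_one_left (mul_nonneg (b0 _ _) (h0 _ _ _)) (b1 _ _)).trans
        (mul_le_of_le_one_right (b0 _ _) (h1 _ _ _))
    have t2 : ∀ j q, b j (X j) * (b q (X q) * h j q (X j, X q)) ≤ b j (X j) := fun j q =>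
      mul_le_of_le_one_right (b0 _ _) (mul_le_one₀ (b1 _ _) (h0 _ _ _) (h1 _ _ _))
    have edeg : gbmDeg (2 * k) k rs rd (Function.update X i x) i = D X - b i (X i) := by
      unfold gbmDeg
      simp only [eA, hD]
      rw [eq_sub_iff_add_eq, ← Finset.add_sum_erase _ _ (Finset.mem_univ i),
        ← Finset.add_sum_erase _ (fun j => b j (X j)) (Finset.mem_univ i), if_pos rfl, zero_add,
        add_comm]
      congr 1
      exact Finset.sum_congr rfl fun j hj => if_neg (Ne.symm (Finset.ne_of_mem_erase hj))
    have etri : localTri (2 * k) k rs rd (Function.update X i x) i = ∑ j, ∑ q,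
        if j ≠ i ∧ q ≠ i ∧ j ≠ q then b j (X j) * (b q (X q) * h j q (X j, X q)) else 0 := by
      unfold localTri
      exact Finset.sum_congr rfl fun j _ => Finset.sum_congr rfl fun q _ => eT j q
    have hbi0 := b0 i (X i)
    have hbi1 := b1 i (X i)
    unfold locC
    apply cc_pointwise hl8 (limM_nonneg hrd hds) (limM_le_one hrd hds) (localTri_nonneg ..) _ _
      (localTri_le ..) (gbmDeg_nonneg ..)
    · rw [edeg]; linarith
    · rw [edeg]; linarith
    · rw [etri]
      refine Finset.sum_le_sum fun j _ => Finset.sum_le_sum fun q _ => ?_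
      split_ifs
      · exact le_rfl
      · exact t0 j q
    · rw [etri]
      have e3 : ∑ j, ∑ q, ((if j = i then b q (X q) else 0) + (if q = i then b j (X j) else 0) +
          (if j = q then b j (X j) else 0)) = 3 * D X := by
        simp only [Finset.sum_add_distrib, Finset.sum_ite_eq, Finset.sum_ite_eq', Finset.mem_univ,
          if_true]
        rw [Finset.sum_comm]
        simp only [Finset.sum_ite_eq', Finset.mem_univ, if_true, hD]
        ring
      rw [← e3, ← Finset.sum_add_distrib]
      refine Finset.sum_le_sum fun j _ => ?_
      rw [← Finset.sum_add_distrib]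
      refine Finset.sum_le_sum fun q _ => ?_
      have u1 := t1 j q
      have u2 := t2 j q
      have u3 := b0 j (X j)
      have u4 := b0 q (X q)
      by_cases c1 : j = i
      · have c1' : ¬ (j ≠ i ∧ q ≠ i ∧ j ≠ q) := by tauto
        rw [if_neg c1', if_pos c1]
        split_ifs <;> linarith
      · by_cases c2 : q = i
        · have c1' : ¬ (j ≠ i ∧ q ≠ i ∧ j ≠ q) := by tauto
          rw [if_neg c1', if_neg c1, if_pos c2]
          split_ifs <;> linarith
        · by_cases c3 : j = q
          · have c1' : ¬ (j ≠ i ∧ q ≠ i ∧ j ≠ q) := by tauto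
            rw [if_neg c1', if_neg c1, if_neg c2, if_pos c3]
            linarith
          · rw [if_pos ⟨c1, c2, c3⟩, if_neg c1, if_neg c2, if_neg c3]
            linarith
  have i1 : BM fun X => |T X - limM rs rd * l ^ 2| := (TBM.sub (BM.const _)).abs
  have i2 : BM fun X => (D X - l) ^ 2 := (DBM.sub (BM.const _)).pow 2
  have i3 : BM fun X => 2 * l * |D X - l| := (BM.const _).mul (DBM.sub (BM.const _)).abs
  have i4 : BM fun X => 6 * D X := (BM.const _).mul DBM
  have i5 : BM fun X => 6 * D X + 2 := i4.add (BM.const _)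
  have i6 : BM fun X => |locC (2 * k) k rs rd (Function.update X i x) i - limM rs rd| :=
    (((locC_BM (2 * k) k rs rd i).comp
      ((meas_upd i).comp (measurable_const.prodMk measurable_id))).sub (BM.const _)).abs
  calc _ ≤ ∫ X, (16 / l ^ 2 * (|T X - limM rs rd * l ^ 2| + ((D X - l) ^ 2 + 2 * l * |D X - l|) +
        (6 * D X + 2)) + 8 / l ^ 2 * (D X - l) ^ 2) ∂sampP (2 * k) :=
        integral_mono (i6.integrable _) ((((BM.const _).mul ((i1.add (i2.add i3)).add i5)).add
          ((BM.const _).mul i2)).integrable _) hpt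
    _ = 16 / l ^ 2 * (∫ X, |T X - limM rs rd * l ^ 2| ∂sampP (2 * k) +
        (∫ X, (D X - l) ^ 2 ∂sampP (2 * k) + 2 * l * ∫ X, |D X - l| ∂sampP (2 * k)) +
        (6 * l + 2)) + 8 / l ^ 2 * ∫ X, (D X - l) ^ 2 ∂sampP (2 * k) := by
        rw [integral_add (((BM.const _).mul ((i1.add (i2.add i3)).add i5)).integrable _)
          (((BM.const _).mul i2).integrable _), integral_const_mul, integral_const_mul,
          integral_add ((i1.add (i2.add i3)).integrable _) (i5.integrable _),
          integral_add (i1.integrable _) ((i2.add i3).integrable _),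
          integral_add (i2.integrable _) (i3.integrable _), integral_const_mul,
          integral_add (i4.integrable _) ((BM.const _).integrable _), integral_const_mul, hmean]
        simp
    _ ≤ 16 / l ^ 2 * ((l + 2 * (l * √l)) + (l + 2 * l * √l) + (6 * l + 2)) + 8 / l ^ 2 * l := by
        gcongr
    _ ≤ 232 / √l := by
        obtain ⟨t, ht⟩ : ∃ t, t = √l := ⟨_, rfl⟩
        have ht2 : l = t ^ 2 := by rw [ht, Real.sq_sqrt hlpos.le]
        rw [← ht]
        have htp : 0 < t := by rw [ht]; exact hsl
        rw [ht2]
        have ht1 : 1 ≤ t := by nlinarith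
        rw [← sub_nonneg]
        have e : 232 / t - (16 / (t ^ 2) ^ 2 * ((t ^ 2 + 2 * (t ^ 2 * t)) +
            (t ^ 2 + 2 * t ^ 2 * t) + (6 * t ^ 2 + 2)) + 8 / (t ^ 2) ^ 2 * t ^ 2) =
            (168 * t ^ 3 - 136 * t ^ 2 - 32) / t ^ 4 := by
          field_simp
          ring
        rw [e]
        apply div_nonneg _ (by positivity)
        have : t ^ 2 ≤ t ^ 3 := pow_le_pow_right₀ ht1 (by norm_num)
        have : 1 ≤ t ^ 3 := one_le_pow₀ ht1
        nlinarith

lemma avg_bound (hrd : 0 < rd) (hds : rd ≤ rs) (hs4 : rs ≤ 1 / 4) {l : ℝ}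
    (hl : l = 2 * k * (rs + rd)) (hl8 : 8 ≤ l) :
    ∫ X, |avgCC (2 * k) k rs rd X - limM rs rd| ∂sampP (2 * k) ≤ 232 / √l := by
  have hk : 0 < k := by
    rcases Nat.eq_zero_or_pos k with h | h
    · subst h; simp at hl; linarith
    · exact h
  have hn : (0 : ℝ) < ((2 * k : ℕ) : ℝ) := by
    have : 0 < 2 * k := by omega
    exact_mod_cast this
  have cBM : ∀ i, BM fun X => |locC (2 * k) k rs rd X i - limM rs rd| := fun i =>
    ((locC_BM _ _ _ _ i).sub (BM.const _)).abs
  have hv : ∀ i, ∫ X, |locC (2 * k) k rs rd X i - limM rs rd| ∂sampP (2 * k) ≤ 232 / √l := by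
    intro i
    have := integral_upd_le i (cBM i) (BM.const (232 / √l))
      (fun x hx => vertex_bound hrd hds hs4 hl hl8 i hx)
    simpa using this
  have aBM : BM fun X => |avgCC (2 * k) k rs rd X - limM rs rd| :=
    (((BM.const _).mul (BM.sum _ fun i => locC_BM (2 * k) k rs rd i)).sub (BM.const _)).abs
  calc _ ≤ ∫ X, (1 / ((2 * k : ℕ) : ℝ)) * ∑ i, |locC (2 * k) k rs rd X i - limM rs rd|
        ∂sampP (2 * k) := by
        apply integral_mono (aBM.integrable _)
          (((BM.const _).mul (BM.sum _ cBM)).integrable _)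
        intro X
        simp only
        have e : avgCC (2 * k) k rs rd X - limM rs rd =
            (1 / ((2 * k : ℕ) : ℝ)) * ∑ i, (locC (2 * k) k rs rd X i - limM rs rd) := by
          rw [Finset.sum_sub_distrib, mul_sub]
          congr 1
          simp only [Finset.sum_const, Finset.card_univ, Fintype.card_fin, nsmul_eq_mul]
          field_simp
        rw [e, abs_mul, abs_of_pos (by positivity)]
        exact mul_le_mul_of_nonneg_left (Finset.abs_sum_le_sum_abs _ _) (by positivity)
    _ = (1 / ((2 * k : ℕ) : ℝ)) * ∑ i, ∫ X, |locC (2 * k) k rs rd X i - limM rs rd|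
        ∂sampP (2 * k) := by
        rw [integral_const_mul, integral_finsetSum _ fun i _ => (cBM i).integrable _]
    _ ≤ (1 / ((2 * k : ℕ) : ℝ)) * ∑ i : Fin (2 * k), 232 / √l :=
        mul_le_mul_of_nonneg_left (Finset.sum_le_sum fun i _ => hv i) (by positivity)
    _ = 232 / √l := by
        simp only [Finset.sum_const, Finset.card_univ, Fintype.card_fin, nsmul_eq_mul]
        field_simp

end Vertex

lemma limM_eq {rs rd : ℝ} (hrd : 0 < rd) (hds : rd ≤ rs) : limM rs rd =
    if rs < 2 * rd then 3 * rs * rd / (rs + rd) ^ 2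
      else 3 * (rs ^ 2 + 4 * rd ^ 2) / (4 * (rs + rd) ^ 2) := by
  unfold limM mixJ
  have : 0 < rs + rd := by linarith
  split_ifs
  · field_simp
    ring
  · congr 1
    ring

/-- Average clustering coefficient of the balanced GBM (`τ = 1/2`, i.e. `n = 2k`
nodes with communities of size `k`): under `r_s = Θ(r_d)` and `n r_s → ∞`, the
average clustering coefficient converges in probability to
`3 r_s r_d/(r_s+r_d)²` when `r_s < 2 r_d` and to `3(r_s² + 4r_d²)/(4(r_s+r_d)²)`
when `r_s ≥ 2 r_d`. -/
theorem avgCC_limit_balanced (rs rd : ℕ → ℝ)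
    (hrd : ∀ k, 0 < rd k) (hds : ∀ k, rd k ≤ rs k) (hs4 : ∀ k, rs k ≤ 1 / 4)
    (hTheta : ∃ c₁ c₂ : ℝ, 0 < c₁ ∧ 0 < c₂ ∧
      ∀ᶠ k in Filter.atTop, c₁ * rd k ≤ rs k ∧ rs k ≤ c₂ * rd k)
    (hdeg : Filter.Tendsto (fun k : ℕ => ((2 * k : ℕ) : ℝ) * rs k)
      Filter.atTop Filter.atTop)
    (M : ℕ → ℝ)
    (hM : ∀ k, M k =
      if rs k < 2 * rd k then 3 * rs k * rd k / (rs k + rd k) ^ 2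
      else 3 * (rs k ^ 2 + 4 * rd k ^ 2) / (4 * (rs k + rd k) ^ 2)) :
    ∀ ε : ℝ, 0 < ε →
      Filter.Tendsto
        (fun k => gbmMeasure (2 * k)
          {X | ε < |avgCC (2 * k) k (rs k) (rd k) X - M k|})
        Filter.atTop (nhds 0) := by
  intro ε hε
  set l : ℕ → ℝ := fun k => 2 * k * (rs k + rd k) with hl
  have hlt : Filter.Tendsto l Filter.atTop Filter.atTop := by
    refine Filter.tendsto_atTop_mono (fun k => ?_) hdeg
    simp only [hl]
    push_cast
    have : (0 : ℝ) ≤ 2 * k := by positivity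
    exact mul_le_mul_of_nonneg_left (by linarith [hrd k]) this
  have hb : Filter.Tendsto (fun k => ENNReal.ofReal (232 / √(l k) / ε)) Filter.atTop (nhds 0) := by
    rw [← ENNReal.ofReal_zero]
    apply ENNReal.tendsto_ofReal
    have h1 : Filter.Tendsto (fun k => 232 / √(l k)) Filter.atTop (nhds 0) :=
      Filter.Tendsto.const_div_atTop (Real.tendsto_sqrt_atTop.comp hlt) 232
    simpa using h1.div_const ε
  refine tendsto_of_tendsto_of_tendsto_of_le_of_le' tendsto_const_nhds hb
    (Filter.Eventually.of_forall fun _ => zero_le) ?_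
  filter_upwards [hlt.eventually_ge_atTop 8] with k hk
  have hMk : M k = limM (rs k) (rd k) := by rw [hM, limM_eq (hrd k) (hds k)]
  have h1 := avg_bound (hrd k) (hds k) (hs4 k) (l := l k) rfl hk
  have aBM : BM fun X => |avgCC (2 * k) k (rs k) (rd k) X - limM (rs k) (rd k)| :=
    (((BM.const _).mul (BM.sum _ fun i => locC_BM (2 * k) k (rs k) (rd k) i)).sub
      (BM.const _)).abs
  have h2 := mul_meas_ge_le_integral_of_nonneg (μ := sampP (2 * k))
    (Filter.Eventually.of_forall fun X => abs_nonneg _) (aBM.integrable _) ε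
  have h3 : (sampP (2 * k)).real
      {X | ε ≤ |avgCC (2 * k) k (rs k) (rd k) X - limM (rs k) (rd k)|} ≤ 232 / √(l k) / ε := by
    rw [le_div_iff₀ hε, mul_comm]
    exact h2.trans h1
  rw [hMk]
  change sampP (2 * k) _ ≤ _
  calc sampP (2 * k) {X | ε < |avgCC (2 * k) k (rs k) (rd k) X - limM (rs k) (rd k)|}
      ≤ sampP (2 * k) {X | ε ≤ |avgCC (2 * k) k (rs k) (rd k) X - limM (rs k) (rd k)|} :=
        measure_mono fun X (hX : ε < _) => hX.le
    _ ≤ _ := by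
        rw [← ofReal_measureReal]
        exact ENNReal.ofReal_le_ofReal h3
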